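/- arXiv:2010.05944 — 3 statements merged into one kernel-verified Lean document; each statement's English description precedes it below -/
import Mathlib

section
/- Let m,n,q∈ℕ with q≥3, let χ be a Dirichlet character mod q, and define S_q(m,n) := ∑_{χ₁,χ₂ mod q, χ₁χ₂=χ} χ₁*(m)·χ₂*(n), where χ* denotes the primitive character inducing a character. Then for any primes p₁,p₂, integers e₁,e₂≥1, and ν₁,ν₂≥0 with p₁^{ν₁}∥q and p₂^{ν₂}∥q: (i) if gcd(p₁p₂,q)=1, S_q(p₁^{e₁},p₂^{e₂}) = χ(p₁^{e₁})·φ(q)·1[p₁^{e₁}≡p₂^{e₂} (mod q)]; (ii) if p₁∣q and p₂∤q, it equals χ(p₂^{e₂})·φ(q/p₁^{ν₁})·1[p₁^{e₁}≡p₂^{e₂} (mod q/p₁^{ν₁})]; (iii) if p₁∤q and p₂∣q, it equals χ(p₁^{e₁})·φ(q/p₂^{ν₂})·1[p₁^{e₁}≡p₂^{e₂} (mod q/p₂^{ν₂})]; (iv) if p₁∣q and p₂=p₁, it equals 1[cond(χ)∣q/p₁^{ν₁}]·χ(p₁^{e₁}+q/p₁^{ν₁})·φ(q/p₁^{ν₁})·1[p₁^{e₁}≡p₁^{e₂}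 (mod q/p₁^{ν₁})]; (v) if p₁,p₂∣q with p₁≠p₂, it equals χ^{(1)}(p₂^{e₂}+q/p₂^{ν₂})·χ^{(2)}(p₁^{e₁})·χ^{(3)}(p₂^{e₂})·φ(q/(p₁^{ν₁}p₂^{ν₂}))·1[p₁^{e₁}≡p₂^{e₂} (mod q/(p₁^{ν₁}p₂^{ν₂}))], where χ = χ^{(1)}χ^{(2)}χ^{(3)} is the decomposition of χ with χ^{(1)} mod p₁^{ν₁}, χ^{(2)} mod p₂^{ν₂} and χ^{(3)} mod q/(p₁^{ν₁}p₂^{ν₂}). -/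
open scoped Classical

/-- `S_q(m,n) = ∑_{χ₁χ₂ = χ} χ₁*(m) χ₂*(n)`, where `χ*` denotes the primitive character
inducing `χ`. -/
noncomputable def Schar (q : ℕ) [NeZero q] (χ : DirichletCharacter ℂ q) (m n : ℕ) : ℂ :=
  ∑ χ₁ : DirichletCharacter ℂ q, ∑ χ₂ : DirichletCharacter ℂ q,
    if χ₁ * χ₂ = χ then
      χ₁.primitiveCharacter ((m : ℕ) : ZMod χ₁.conductor) *
        χ₂.primitiveCharacter ((n : ℕ) : ZMod χ₂.conductor)
    else 0

namespace DirichletCharacter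

/-- `changeLevel_eq_cast_of_dvd'` for natural numbers coprime to the larger level. -/
lemma changeLevel_natCast {R : Type*} [CommMonoidWithZero R] {n m : ℕ} (hm : n ∣ m)
    (χ : DirichletCharacter R n) {a : ℕ} (ha : a.Coprime m) :
    changeLevel hm χ (a : ZMod m) = χ (a : ZMod n) := by
  simpa using changeLevel_eq_cast_of_dvd' χ hm (Nat.isCoprime_iff_coprime.mpr ha)

lemma primitiveCharacter_changeLevel_natCast {n m : ℕ} [NeZero m] (hm : n ∣ m)
    (χ : DirichletCharacter ℂ n) {a : ℕ} (ha : a.Coprime n) :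
    (changeLevel hm χ).primitiveCharacter (a : ZMod _) = χ (a : ZMod n) := by
  have h₁ := primitiveCharacter_changeLevel_apply hm χ (a : ℤ)
  have h₂ := primitiveCharacter_apply_of_isCoprime χ (Nat.isCoprime_iff_coprime.mpr ha)
  simp only [Int.cast_natCast] at h₁ h₂
  rw [h₁, h₂]

/-- At a positive power of `p`, the primitive character inducing `χ` vanishes unless the conductor
of `χ` divides the prime-to-`p` part of the level. -/
lemma primitiveCharacter_prime_pow_eq_zero {q p ν e : ℕ} (hp : p.Prime) (he : 1 ≤ e)
    (hν : p ^ ν ∣ q) (χ : DirichletCharacter ℂ q) (hχ : ¬ χ.conductor ∣ q / p ^ ν) :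
    χ.primitiveCharacter ((p ^ e : ℕ) : ZMod χ.conductor) = 0 := by
  have h : p ∣ χ.conductor := by
    by_contra h
    refine hχ (Nat.Coprime.dvd_of_dvd_mul_left
      (Nat.Coprime.pow_right ν ((Nat.Prime.coprime_iff_not_dvd hp).mpr h).symm) ?_)
    rw [Nat.mul_div_cancel' hν]
    exact χ.conductor_dvd_level
  refine MulChar.map_nonunit _ fun hu ↦ ?_
  rw [ZMod.isUnit_iff_coprime] at hu
  exact hp.one_lt.ne' (Nat.eq_one_of_dvd_coprimes hu (dvd_pow_self p (by lia)) h)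

/-- Orthogonality of Dirichlet characters, in terms of inverse characters. -/
lemma sum_apply_mul_inv_apply {N : ℕ} [NeZero N] (a : ZMod N) {b : ZMod N} (hb : IsUnit b) :
    ∑ θ : DirichletCharacter ℂ N, θ a * θ⁻¹ b = (N.totient : ℂ) * (if a = b then 1 else 0) := by
  have h := sum_char_inv_mul_char_eq ℂ hb a
  rw [mul_ite, mul_one, mul_zero]
  simp only [eq_comm (a := a)]
  rw [← h]
  refine Finset.sum_congr rfl fun θ _ ↦ ?_
  rw [mul_comm, MulChar.inv_apply_eq_inv']
  congr 1
  refine inv_eq_of_mul_eq_one_right ?_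
  rw [← map_mul, ZMod.mul_inv_of_unit b hb, map_one]

/-- Two ways of writing a character as a product of characters of levels `Q₁` and `Q₂` differ by
a character of level `gcd Q₁ Q₂`. -/
lemma exists_of_changeLevel_mul_eq {q Q₁ Q₂ N : ℕ} [NeZero q] (hQ₁ : Q₁ ∣ q) (hQ₂ : Q₂ ∣ q)
    (hN₁ : N ∣ Q₁) (hN : Q₁.gcd Q₂ = N)
    {α ψ₁ : DirichletCharacter ℂ Q₁} {β ψ₂ : DirichletCharacter ℂ Q₂}
    (h : changeLevel hQ₁ ψ₁ * changeLevel hQ₂ ψ₂ = changeLevel hQ₁ α * changeLevel hQ₂ β) :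
    ∃ θ : DirichletCharacter ℂ N, ψ₁ = α * changeLevel hN₁ θ := by
  have key : changeLevel hQ₁ (ψ₁ * α⁻¹) = changeLevel hQ₂ (β * ψ₂⁻¹) := by
    rw [map_mul, map_mul, map_inv, map_inv, ← div_eq_mul_inv, ← div_eq_mul_inv,
      div_eq_div_iff_mul_eq_mul, h, mul_comm]
  have hc : (changeLevel hQ₁ (ψ₁ * α⁻¹)).conductor ∣ N := by
    rw [← hN]
    refine Nat.dvd_gcd ?_ ?_
    · exact conductor_dvd_of_mem_conductorSet _ ⟨hQ₁, _, rfl⟩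
    · exact conductor_dvd_of_mem_conductorSet _ ⟨hQ₂, _, key⟩
  obtain ⟨_, θ, hθ⟩ := (mem_conductorSet_iff_conductor_dvd _ (hN₁.trans hQ₁)).mpr hc
  rw [changeLevel_trans _ hN₁ hQ₁] at hθ
  refine ⟨θ, ?_⟩
  rw [← changeLevel_injective hQ₁ hθ]
  simp

end DirichletCharacter

open DirichletCharacter

lemma Schar_eq_sum_div (q : ℕ) [NeZero q] (χ : DirichletCharacter ℂ q) (m n : ℕ) :
    Schar q χ m n = ∑ χ₁ : DirichletCharacter ℂ q,
      χ₁.primitiveCharacter (m : ZMod χ₁.conductor) *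
        (χ₁⁻¹ * χ).primitiveCharacter (n : ZMod (χ₁⁻¹ * χ).conductor) := by
  refine Finset.sum_congr rfl fun χ₁ _ ↦ ?_
  rw [Finset.sum_eq_single (χ₁⁻¹ * χ)]
  · simp
  · intro χ₂ _ h
    rw [if_neg]
    rintro rfl
    simp at h
  · simp

lemma Schar_comm (q : ℕ) [NeZero q] (χ : DirichletCharacter ℂ q) (m n : ℕ) :
    Schar q χ m n = Schar q χ n m := by
  unfold Schar
  rw [Finset.sum_comm]
  refine Finset.sum_congr rfl fun χ₁ _ ↦ Finset.sum_congr rfl fun χ₂ _ ↦ ?_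
  rw [mul_comm χ₂, mul_comm (χ₂.primitiveCharacter _)]

/-- If only characters factoring through `Q₁` (resp. `Q₂`) contribute at `m` (resp. `n`), then
`Schar` vanishes at a character that is not a product of characters of levels `Q₁` and `Q₂`. -/
lemma Schar_eq_zero {q Q₁ Q₂ m n : ℕ} [NeZero q] (hQ₁ : Q₁ ∣ q) (hQ₂ : Q₂ ∣ q)
    (hm : ∀ χ : DirichletCharacter ℂ q, ¬ χ.conductor ∣ Q₁ →
      χ.primitiveCharacter (m : ZMod χ.conductor) = 0)
    (hn : ∀ χ : DirichletCharacter ℂ q, ¬ χ.conductor ∣ Q₂ →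
      χ.primitiveCharacter (n : ZMod χ.conductor) = 0)
    (χ : DirichletCharacter ℂ q)
    (hχ : ∀ (α : DirichletCharacter ℂ Q₁) (β : DirichletCharacter ℂ Q₂),
      χ ≠ changeLevel hQ₁ α * changeLevel hQ₂ β) :
    Schar q χ m n = 0 := by
  rw [Schar_eq_sum_div]
  refine Finset.sum_eq_zero fun χ₁ _ ↦ ?_
  by_cases h₁ : χ₁.conductor ∣ Q₁
  · by_cases h₂ : (χ₁⁻¹ * χ).conductor ∣ Q₂
    · obtain ⟨_, α, hα⟩ := (mem_conductorSet_iff_conductor_dvd _ hQ₁).mpr h₁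
      obtain ⟨_, β, hβ⟩ := (mem_conductorSet_iff_conductor_dvd _ hQ₂).mpr h₂
      refine absurd ?_ (hχ α β)
      rw [← hα, ← hβ, mul_inv_cancel_left]
    · rw [hn _ h₂, mul_zero]
  · rw [hm _ h₁, zero_mul]

/-- If only characters factoring through `Q₁` (resp. `Q₂`) contribute at `m` (resp. `n`), then
`Schar` at a product `α β` of characters of levels `Q₁` and `Q₂` is given by orthogonality of
characters of level `gcd Q₁ Q₂`. -/
lemma Schar_changeLevel_mul {q Q₁ Q₂ N m n : ℕ} [NeZero q] (hQ₁ : Q₁ ∣ q) (hQ₂ : Q₂ ∣ q)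
    (hN : Q₁.gcd Q₂ = N) (hmc : m.Coprime Q₁) (hnc : n.Coprime Q₂)
    (hm : ∀ χ : DirichletCharacter ℂ q, ¬ χ.conductor ∣ Q₁ →
      χ.primitiveCharacter (m : ZMod χ.conductor) = 0)
    (hn : ∀ χ : DirichletCharacter ℂ q, ¬ χ.conductor ∣ Q₂ →
      χ.primitiveCharacter (n : ZMod χ.conductor) = 0)
    (α : DirichletCharacter ℂ Q₁) (β : DirichletCharacter ℂ Q₂) :
    Schar q (changeLevel hQ₁ α * changeLevel hQ₂ β) m n =
      α (m : ZMod Q₁) * β (n : ZMod Q₂) * (N.totient : ℂ) *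
        (if (m : ZMod N) = (n : ZMod N) then 1 else 0) := by
  have hN₁ : N ∣ Q₁ := hN ▸ Nat.gcd_dvd_left _ _
  have hN₂ : N ∣ Q₂ := hN ▸ Nat.gcd_dvd_right _ _
  have : NeZero N := ⟨fun h ↦ NeZero.ne q (Nat.eq_zero_of_zero_dvd (h ▸ hN₁.trans hQ₁))⟩
  have : NeZero Q₁ := ⟨fun h ↦ NeZero.ne q (Nat.eq_zero_of_zero_dvd (h ▸ hQ₁))⟩
  have hu : IsUnit (n : ZMod N) := (ZMod.isUnit_iff_coprime _ _).mpr (hnc.coprime_dvd_right hN₂)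
  rw [Schar_eq_sum_div, mul_assoc, ← sum_apply_mul_inv_apply _ hu, Finset.mul_sum]
  symm
  refine Fintype.sum_of_injective
    (fun θ : DirichletCharacter ℂ N ↦ changeLevel hQ₁ (α * changeLevel hN₁ θ)) ?_ _ _ ?_ ?_
  · intro θ θ' h
    exact changeLevel_injective hN₁ (mul_left_cancel (changeLevel_injective hQ₁ h))
  · intro χ₁ h
    by_cases h₁ : χ₁.conductor ∣ Q₁
    · by_cases h₂ : (χ₁⁻¹ * (changeLevel hQ₁ α * changeLevel hQ₂ β)).conductor ∣ Q₂
      · obtain ⟨_, ψ₁, hψ₁⟩ := (mem_conductorSet_iff_conductor_dvd _ hQ₁).mpr h₁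
        obtain ⟨_, ψ₂, hψ₂⟩ := (mem_conductorSet_iff_conductor_dvd _ hQ₂).mpr h₂
        have hprod : changeLevel hQ₁ ψ₁ * changeLevel hQ₂ ψ₂ =
            changeLevel hQ₁ α * changeLevel hQ₂ β := by
          rw [← hψ₁, ← hψ₂, mul_inv_cancel_left]
        obtain ⟨θ, hθ⟩ := exists_of_changeLevel_mul_eq hQ₁ hQ₂ hN₁ hN hprod
        exact absurd ⟨θ, by rw [hψ₁, hθ]⟩ h
      · rw [hn _ h₂, mul_zero]
    · rw [hm _ h₁, zero_mul]
  · intro θ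
    have hβ : (changeLevel hQ₁ (α * changeLevel hN₁ θ))⁻¹ *
        (changeLevel hQ₁ α * changeLevel hQ₂ β) =
        changeLevel hQ₂ (β * changeLevel hN₂ θ⁻¹) := by
      rw [map_mul, map_mul, ← changeLevel_trans, ← changeLevel_trans, mul_inv, ← map_inv]
      rw [map_inv, map_inv]
      rw [mul_mul_mul_comm, inv_mul_cancel, one_mul, mul_comm]
    rw [hβ, primitiveCharacter_changeLevel_natCast hQ₁ _ hmc,
      primitiveCharacter_changeLevel_natCast hQ₂ _ hnc, MulChar.mul_apply, MulChar.mul_apply,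
      changeLevel_natCast hN₁ _ hmc, changeLevel_natCast hN₂ _ hnc]
    ring

/-- **Lemma (orthogonality sums `S_q(p₁^{e₁}, p₂^{e₂})`).** -/
theorem moments_of_primes_stmt13
    (q : ℕ) [NeZero q] (hq : 3 ≤ q) (χ : DirichletCharacter ℂ q)
    (p₁ p₂ : ℕ) (hp₁ : p₁.Prime) (hp₂ : p₂.Prime)
    (e₁ e₂ : ℕ) (he₁ : 1 ≤ e₁) (he₂ : 1 ≤ e₂)
    (ν₁ ν₂ : ℕ) (hν₁ : p₁ ^ ν₁ ∣ q ∧ ¬ p₁ ^ (ν₁ + 1) ∣ q)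
    (hν₂ : p₂ ^ ν₂ ∣ q ∧ ¬ p₂ ^ (ν₂ + 1) ∣ q) :
    -- (i) `(p₁p₂, q) = 1`
    (Nat.Coprime (p₁ * p₂) q →
      Schar q χ (p₁ ^ e₁) (p₂ ^ e₂) =
        χ (((p₁ ^ e₁ : ℕ) : ZMod q)) * (q.totient : ℂ) *
          (if ((p₁ ^ e₁ : ℕ) : ZMod q) = ((p₂ ^ e₂ : ℕ) : ZMod q) then 1 else 0)) ∧
    -- (ii) `p₁ ∣ q`, `p₂ ∤ q`
    (p₁ ∣ q → ¬ p₂ ∣ q →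
      Schar q χ (p₁ ^ e₁) (p₂ ^ e₂) =
        χ (((p₂ ^ e₂ : ℕ) : ZMod q)) * ((q / p₁ ^ ν₁).totient : ℂ) *
          (if ((p₁ ^ e₁ : ℕ) : ZMod (q / p₁ ^ ν₁)) = ((p₂ ^ e₂ : ℕ) : ZMod (q / p₁ ^ ν₁))
            then 1 else 0)) ∧
    -- (iii) `p₁ ∤ q`, `p₂ ∣ q`
    (¬ p₁ ∣ q → p₂ ∣ q →
      Schar q χ (p₁ ^ e₁) (p₂ ^ e₂) =
        χ (((p₁ ^ e₁ : ℕ) : ZMod q)) * ((q / p₂ ^ ν₂).totient : ℂ) *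
          (if ((p₁ ^ e₁ : ℕ) : ZMod (q / p₂ ^ ν₂)) = ((p₂ ^ e₂ : ℕ) : ZMod (q / p₂ ^ ν₂))
            then 1 else 0)) ∧
    -- (iv) `p₁ ∣ q`, `p₂ = p₁`
    (p₁ ∣ q → p₂ = p₁ →
      Schar q χ (p₁ ^ e₁) (p₂ ^ e₂) =
        (if χ.conductor ∣ q / p₁ ^ ν₁ then 1 else 0) *
          χ (((p₁ ^ e₁ + q / p₁ ^ ν₁ : ℕ) : ZMod q)) * ((q / p₁ ^ ν₁).totient : ℂ) *
          (if ((p₁ ^ e₁ : ℕ) : ZMod (q / p₁ ^ ν₁)) = ((p₁ ^ e₂ : ℕ) : ZMod (q / p₁ ^ ν₁))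
            then 1 else 0)) ∧
    -- (v) `p₁, p₂ ∣ q`, `p₁ ≠ p₂`
    (p₁ ∣ q → p₂ ∣ q → p₁ ≠ p₂ →
      ∀ (hd1 : p₁ ^ ν₁ ∣ q) (hd2 : p₂ ^ ν₂ ∣ q) (hd3 : q / (p₁ ^ ν₁ * p₂ ^ ν₂) ∣ q)
        (χ1 : DirichletCharacter ℂ (p₁ ^ ν₁)) (χ2 : DirichletCharacter ℂ (p₂ ^ ν₂))
        (χ3 : DirichletCharacter ℂ (q / (p₁ ^ ν₁ * p₂ ^ ν₂))),
        χ = DirichletCharacter.changeLevel hd1 χ1 * DirichletCharacter.changeLevel hd2 χ2 *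
              DirichletCharacter.changeLevel hd3 χ3 →
        Schar q χ (p₁ ^ e₁) (p₂ ^ e₂) =
          χ1 (((p₂ ^ e₂ + q / p₂ ^ ν₂ : ℕ) : ZMod (p₁ ^ ν₁))) *
            χ2 (((p₁ ^ e₁ : ℕ) : ZMod (p₂ ^ ν₂))) *
            χ3 (((p₂ ^ e₂ : ℕ) : ZMod (q / (p₁ ^ ν₁ * p₂ ^ ν₂)))) *
            ((q / (p₁ ^ ν₁ * p₂ ^ ν₂)).totient : ℂ) *
            (if ((p₁ ^ e₁ : ℕ) : ZMod (q / (p₁ ^ ν₁ * p₂ ^ ν₂)))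
                = ((p₂ ^ e₂ : ℕ) : ZMod (q / (p₁ ^ ν₁ * p₂ ^ ν₂))) then 1 else 0)) := by
  have cop : ∀ {p ν : ℕ}, p.Prime → p ^ ν ∣ q ∧ ¬ p ^ (ν + 1) ∣ q → p.Coprime (q / p ^ ν) := by
    intro p ν hp h
    refine (Nat.Prime.coprime_iff_not_dvd hp).mpr fun hd ↦ h.2 ?_
    have := Nat.mul_dvd_mul_left (p ^ ν) hd
    rwa [Nat.mul_div_cancel' h.1, ← pow_succ] at this
  have c₁ : (p₁ ^ e₁).Coprime (q / p₁ ^ ν₁) := (cop hp₁ hν₁).pow_left e₁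
  have c₂ : (p₂ ^ e₂).Coprime (q / p₂ ^ ν₂) := (cop hp₂ hν₂).pow_left e₂
  have z₁ := primitiveCharacter_prime_pow_eq_zero hp₁ he₁ hν₁.1
  have z₂ := primitiveCharacter_prime_pow_eq_zero hp₂ he₂ hν₂.1
  have d₁ : q / p₁ ^ ν₁ ∣ q := Nat.div_dvd_of_dvd hν₁.1
  have d₂ : q / p₂ ^ ν₂ ∣ q := Nat.div_dvd_of_dvd hν₂.1
  have triv : ∀ {p ν : ℕ}, p ^ ν ∣ q → ¬ p ∣ q → q / p ^ ν = q := by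
    intro p ν h hd
    rcases Nat.eq_zero_or_pos ν with rfl | hν
    · simp
    · exact absurd ((dvd_pow_self p hν.ne').trans h) hd
  refine ⟨fun hc ↦ ?_, fun h₁ h₂ ↦ ?_, fun h₁ h₂ ↦ ?_, fun h₁ h₂ ↦ ?_, ?_⟩
  · have n₁ : ¬ p₁ ∣ q := (Nat.Prime.coprime_iff_not_dvd hp₁).mp hc.coprime_mul_right
    have n₂ : ¬ p₂ ∣ q := (Nat.Prime.coprime_iff_not_dvd hp₂).mp hc.coprime_mul_left
    rw [triv hν₁.1 n₁] at c₁ z₁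
    rw [triv hν₂.1 n₂] at c₂ z₂
    have := Schar_changeLevel_mul dvd_rfl dvd_rfl (Nat.gcd_self q) c₁ c₂ z₁ z₂ χ 1
    rwa [map_one, mul_one, changeLevel_self,
      MulChar.one_apply ((ZMod.isUnit_iff_coprime _ _).mpr c₂), mul_one] at this
  · rw [triv hν₂.1 h₂] at c₂ z₂
    have := Schar_changeLevel_mul d₁ dvd_rfl (Nat.gcd_eq_left d₁) c₁ c₂ z₁ z₂ 1 χ
    rwa [map_one, one_mul, changeLevel_self,
      MulChar.one_apply ((ZMod.isUnit_iff_coprime _ _).mpr c₁), one_mul] at this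
  · rw [triv hν₁.1 h₁] at c₁ z₁
    have := Schar_changeLevel_mul dvd_rfl d₂ (Nat.gcd_eq_right d₂) c₁ c₂ z₁ z₂ χ 1
    rwa [map_one, mul_one, changeLevel_self,
      MulChar.one_apply ((ZMod.isUnit_iff_coprime _ _).mpr c₂), mul_one] at this
  · subst h₂
    have hν : ν₂ = ν₁ := by
      refine le_antisymm ?_ ?_
      · by_contra h
        exact hν₁.2 ((pow_dvd_pow _ (by lia)).trans hν₂.1)
      · by_contra h
        exact hν₂.2 ((pow_dvd_pow _ (by lia)).trans hν₁.1)
    subst hν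
    by_cases hχ : χ.conductor ∣ q / p₂ ^ ν₂
    · obtain ⟨_, α, rfl⟩ := (mem_conductorSet_iff_conductor_dvd _ d₁).mpr hχ
      have hc : (p₂ ^ e₁ + q / p₂ ^ ν₂).Coprime q := by
        have hq' : q = p₂ ^ ν₂ * (q / p₂ ^ ν₂) := (Nat.mul_div_cancel' hν₁.1).symm
        conv_rhs => rw [hq']
        refine Nat.Coprime.mul_right (Nat.Coprime.pow_right _ ?_) ?_
        · refine ((Nat.Prime.coprime_iff_not_dvd hp₁).mpr fun hd ↦ ?_).symm
          exact (Nat.Prime.coprime_iff_not_dvd hp₁).mp (cop hp₁ hν₁)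
            ((Nat.dvd_add_right (dvd_pow_self _ (by lia))).mp hd)
        · simpa using c₁
      have := Schar_changeLevel_mul d₁ d₁ (Nat.gcd_self _) c₁ c₂ z₁ z₂ α 1
      rw [map_one, mul_one, MulChar.one_apply ((ZMod.isUnit_iff_coprime _ _).mpr c₂),
        mul_one] at this
      rw [this, if_pos hχ, one_mul, changeLevel_natCast _ _ hc, Nat.cast_add, ZMod.natCast_self,
        add_zero]
    · rw [if_neg hχ, zero_mul, zero_mul, zero_mul]
      refine Schar_eq_zero d₁ d₁ z₁ z₂ χ ?_
      rintro α β rfl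
      exact hχ (conductor_dvd_of_mem_conductorSet _ ⟨d₁, α * β, (map_mul _ _ _).symm⟩)
  · rintro - - hne hd1 hd2 hd3 χ1 χ2 χ3 rfl
    have hcop : (p₁ ^ ν₁).Coprime (p₂ ^ ν₂) :=
      Nat.Coprime.pow _ _ ((Nat.coprime_primes hp₁ hp₂).mpr hne)
    obtain ⟨N, hN⟩ := hcop.mul_dvd_of_dvd_of_dvd hd1 hd2
    have pos₁ : 0 < p₁ ^ ν₁ := pow_pos hp₁.pos _
    have pos₂ : 0 < p₂ ^ ν₂ := pow_pos hp₂.pos _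
    have hN₁ : q / p₁ ^ ν₁ = p₂ ^ ν₂ * N := by
      rw [hN, mul_assoc, Nat.mul_div_cancel_left _ pos₁]
    have hN₂ : q / p₂ ^ ν₂ = p₁ ^ ν₁ * N := by
      rw [hN, mul_comm (p₁ ^ ν₁), mul_assoc, Nat.mul_div_cancel_left _ pos₂]
    have hN₃ : q / (p₁ ^ ν₁ * p₂ ^ ν₂) = N := by
      rw [hN, Nat.mul_div_cancel_left _ (Nat.mul_pos pos₁ pos₂)]
    have hgcd : (q / p₁ ^ ν₁).gcd (q / p₂ ^ ν₂) = q / (p₁ ^ ν₁ * p₂ ^ ν₂) := by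
      rw [hN₁, hN₂, hN₃, Nat.gcd_mul_right, hcop.symm.gcd_eq_one, one_mul]
    have l₁ : p₂ ^ ν₂ ∣ q / p₁ ^ ν₁ := hN₁ ▸ Nat.dvd_mul_right _ _
    have l₂ : p₁ ^ ν₁ ∣ q / p₂ ^ ν₂ := hN₂ ▸ Nat.dvd_mul_right _ _
    have l₃ : q / (p₁ ^ ν₁ * p₂ ^ ν₂) ∣ q / p₂ ^ ν₂ := hgcd ▸ Nat.gcd_dvd_right _ _
    have := Schar_changeLevel_mul d₁ d₂ hgcd c₁ c₂ z₁ z₂ (changeLevel l₁ χ2)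
      (changeLevel l₂ χ1 * changeLevel l₃ χ3)
    rw [map_mul, ← changeLevel_trans, ← changeLevel_trans, ← changeLevel_trans,
      MulChar.mul_apply, changeLevel_natCast l₁ _ c₁, changeLevel_natCast l₂ _ c₂,
      changeLevel_natCast l₃ _ c₂] at this
    rw [mul_comm (changeLevel hd1 χ1), mul_assoc, this, Nat.cast_add (p₂ ^ e₂),
      (ZMod.natCast_eq_zero_iff _ _).mpr l₂, add_zero]
    ring
end

section
/- Assume GRH and LI. Let q ≥ 3, let χ₁,…,χ_n be non-principal Dirichlet characters mod q, and let γ₁,…,γ_n be real numbers such that, for each j, 1/2 + iγ_j is a nontrivial zero of L(s,χ_j). If γ₁+⋯+γ_n = 0, then n = 2m is even, and there exist indices i₁,…,i_m, j₁,…,j_m with {i₁,…,i_m,j₁,…,j_m} = {1,…,2m} such that for each k: γ_{i_k} + γ_{j_k} = 0 and χ_{j_k} is the complex conjugate character of χ_{i_k}. -/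
/-- Order of vanishing (multiplicity) of `f` at `ρ`. -/
noncomputable def zeroOrder (f : ℂ → ℂ) (ρ : ℂ) : ℕ :=
  sInf {k : ℕ | iteratedDeriv k f ρ ≠ 0}
/-- The Generalized Riemann Hypothesis for Dirichlet L-functions: every zero `ρ` with
`0 < Re ρ < 1` of `L(s,χ)` satisfies `Re ρ = 1/2`. -/
def GRH : Prop :=
  ∀ (q : ℕ) [NeZero q] (χ : DirichletCharacter ℂ q) (ρ : ℂ),
    DirichletCharacter.LFunction χ ρ = 0 → 0 < ρ.re → ρ.re < 1 → ρ.re = 1 / 2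
/-- The Linear Independence hypothesis: for each `q ≥ 3`, the multiset of nonnegative
imaginary parts of zeros `ρ` with `Re ρ ≥ 1/2` of `L(s,χ)`, over all Dirichlet characters
`χ` mod `q` and counted with multiplicity, is linearly independent over `ℚ`. -/
def LI : Prop :=
  ∀ (q : ℕ) [NeZero q], 3 ≤ q →
    LinearIndependent ℚ (fun z : {p : DirichletCharacter ℂ q × ℂ × ℕ //
        1/2 ≤ p.2.1.re ∧ 0 ≤ p.2.1.im ∧ DirichletCharacter.LFunction p.1 p.2.1 = 0 ∧
        p.2.2 < zeroOrder (DirichletCharacter.LFunction p.1) p.2.1} => z.1.2.1.im)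

/-- A zero of an entire function that is not identically
zero has positive order. -/
lemma zeroOrder_pos {f : ℂ → ℂ} (hf : Differentiable ℂ f) {w ρ : ℂ} (hw : f w ≠ 0)
    (hρ : f ρ = 0) : 0 < zeroOrder f ρ := by
  have hne : {k : ℕ | iteratedDeriv k f ρ ≠ 0}.Nonempty := by
    by_contra h
    have h0 : ∀ k, iteratedDeriv k f ρ = 0 := fun k ↦ by
      by_contra hk
      exact h ⟨k, hk⟩
    apply hw
    rw [← Complex.taylorSeries_eq_of_entire' ρ w hf]
    simp [h0]
  refine Nat.pos_of_ne_zero fun h ↦ ?_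
  have hmem : iteratedDeriv (zeroOrder f ρ) f ρ ≠ 0 := Nat.sInf_mem hne
  rw [h, iteratedDeriv_zero] at hmem
  exact hmem hρ

namespace DirichletCharacter

open scoped ComplexConjugate

lemma conj_LSeries {q : ℕ} (χ : DirichletCharacter ℂ q) (s : ℂ) :
    conj (LSeries (χ ·) s) = LSeries (χ⁻¹ ·) (conj s) := by
  rw [LSeries, LSeries, Complex.conj_tsum]
  refine tsum_congr fun n ↦ ?_
  rcases eq_or_ne n 0 with rfl | hn
  · simp
  · have hpow : (n : ℂ) ^ conj s = conj ((n : ℂ) ^ s) := by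
      rw [Complex.cpow_conj _ _ (by simp [Complex.natCast_arg, Real.pi_ne_zero.symm]),
        Complex.conj_natCast]
    rw [LSeries.term_of_ne_zero hn, LSeries.term_of_ne_zero hn, map_div₀, hpow,
      ← MulChar.star_apply' χ, starRingEnd_apply]

lemma conj_LFunction {q : ℕ} [NeZero q] {χ : DirichletCharacter ℂ q} (hχ : χ ≠ 1) (s : ℂ) :
    conj (LFunction χ s) = LFunction χ⁻¹ (conj s) := by
  have hdiff : Differentiable ℂ (conj ∘ LFunction χ⁻¹ ∘ conj) := fun s ↦ by
    simpa using (differentiable_LFunction (inv_ne_one.mpr hχ) (conj s)).conj_conj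
  have heq : LFunction χ = conj ∘ LFunction χ⁻¹ ∘ conj := by
    refine AnalyticOnNhd.eq_of_eventuallyEq (𝕜 := ℂ) (z₀ := 2)
      (fun z _ ↦ (differentiable_LFunction hχ).analyticAt z) (fun z _ ↦ hdiff.analyticAt z) ?_
    have hopen : IsOpen {s : ℂ | 1 < s.re} := isOpen_lt continuous_const Complex.continuous_re
    filter_upwards [hopen.mem_nhds (show (2 : ℂ) ∈ {s : ℂ | 1 < s.re} by simp)] with s hs
    have hs' : 1 < (conj s).re := by simpa using hs
    simp only [Function.comp_apply]
    rw [LFunction_eq_LSeries χ hs, LFunction_eq_LSeries χ⁻¹ hs', ← conj_LSeries, Complex.conj_conj]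
  rw [heq]
  simp

lemma zeroOrder_LFunction_pos {q : ℕ} [NeZero q] {χ : DirichletCharacter ℂ q} (hχ : χ ≠ 1) {ρ : ℂ}
    (hρ : LFunction χ ρ = 0) : 0 < zeroOrder (LFunction χ) ρ :=
  zeroOrder_pos (differentiable_LFunction hχ)
    (LFunction_ne_zero_of_one_le_re χ (s := 2) (.inl hχ) (by simp)) hρ

end DirichletCharacter

/-- If every fibre of `f` contains as many indices satisfying `p` as not, the indices can be
grouped into pairs inside the fibres, each pair having one index of either kind. -/
lemma exists_pairing {ι : Type*} {n : ℕ} (f : Fin n → ι) (p : Fin n → Prop)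
    (h : ∀ z, Nat.card {x : {j // p j} // f x = z} = Nat.card {x : {j // ¬ p j} // f x = z}) :
    ∃ m : ℕ, n = 2 * m ∧ ∃ i j : Fin m → Fin n, Set.range i ∪ Set.range j = Set.univ ∧
      ∀ k, f (i k) = f (j k) ∧ p (i k) ∧ ¬ p (j k) := by
  classical
  let e (z : ι) : {x : {j // p j} // f x = z} ≃ {x : {j // ¬ p j} // f x = z} :=
    (Finite.card_eq.mp (h z)).some
  let E : {j // p j} ≃ {j // ¬ p j} :=
    ((Equiv.sigmaFiberEquiv fun x : {j // p j} ↦ f x).symm.trans (Equiv.sigmaCongrRight e)).trans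
      (Equiv.sigmaFiberEquiv fun x : {j // ¬ p j} ↦ f x)
  have hE : ∀ x, f (E x) = f x := fun x ↦ (e (f x) ⟨x, rfl⟩).2
  let F : Fin (Fintype.card {j // p j}) ≃ {j // p j} := (Fintype.equivFin _).symm
  refine ⟨Fintype.card {j // p j}, ?_, fun k ↦ F k, fun k ↦ E (F k), ?_, fun k ↦
    ⟨(hE _).symm, (F k).2, (E (F k)).2⟩⟩
  · have h1 := Fintype.card_subtype_compl p
    have h2 := Fintype.card_subtype_le p
    rw [← Fintype.card_congr E, Fintype.card_fin] at h1
    rw [Fintype.card_fin] at h2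
    omega
  · refine Set.eq_univ_of_forall fun x ↦ ?_
    by_cases hx : p x
    · exact .inl ⟨F.symm ⟨x, hx⟩, by simp⟩
    · exact .inr ⟨F.symm (E.symm ⟨x, hx⟩), by simp⟩

/-- A vanishing signed sum of members of a linearly independent family has, for each member, as
many positive as negative occurrences. -/
lemma LinearIndependent.card_eq_of_signed_sum_eq_zero {ι : Type*} {v : ι → ℝ}
    (hv : LinearIndependent ℚ v) {n : ℕ} (f : Fin n → ι) (p : Fin n → Prop) [DecidablePred p]
    (h : ∑ j, (if p j then v (f j) else - v (f j)) = 0) (z : ι) :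
    Nat.card {x : {j // p j} // f x = z} = Nat.card {x : {j // ¬ p j} // f x = z} := by
  classical
  let l : ι →₀ ℚ := ∑ j, Finsupp.single (f j) (if p j then 1 else -1)
  have hl : l = 0 := by
    refine linearIndependent_iff.mp hv l ?_
    rw [← h, map_sum]
    refine Finset.sum_congr rfl fun j _ ↦ ?_
    rw [Finsupp.linearCombination_single]
    split_ifs <;> simp
  have hz : ∑ j, (if f j = z then (if p j then (1 : ℚ) else -1) else 0) = 0 := by
    have := DFunLike.congr_fun hl z
    simpa [l, Finsupp.finsetSum_apply, Finsupp.single_apply] using this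
  have hsplit : ∀ j, (if f j = z then (if p j then (1 : ℚ) else -1) else 0) =
      (if p j ∧ f j = z then 1 else 0) - (if ¬ p j ∧ f j = z then 1 else 0) := fun j ↦ by
    by_cases h1 : f j = z <;> by_cases h2 : p j <;> simp [h1, h2]
  simp only [hsplit, Finset.sum_sub_distrib, Finset.sum_boole, sub_eq_zero, Nat.cast_inj] at hz
  have hcard : ∀ r : Fin n → Prop, Nat.card {x : {j // r j} // f x = z} =
      (Finset.univ.filter fun j ↦ r j ∧ f j = z).card := fun r ↦ by
    rw [Nat.card_congr (Equiv.subtypeSubtypeEquivSubtypeInter r (f · = z)), Nat.card_eq_fintype_card,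
      Fintype.card_subtype]
  rw [hcard, hcard]
  convert! hz

/-- **Lemma (structure of vanishing sums of zero ordinates, under GRH and LI).**
If `γ₁ + ⋯ + γ_n = 0` where each `1/2 + iγ_j` is a zero of `L(s,χ_j)` with `χ_j` non-principal
mod `q`, then `n = 2m` and the indices pair up as `{i₁,…,i_m,j₁,…,j_m} = {1,…,2m}` with
`γ_{i_k} + γ_{j_k} = 0` and `χ_{j_k} = conj χ_{i_k}`. -/
theorem moments_of_primes_stmt17 (hGRH : GRH) (hLI : LI) :
    ∀ (q : ℕ) [NeZero q], 3 ≤ q → ∀ (n : ℕ)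
      (χ : Fin n → DirichletCharacter ℂ q) (γ : Fin n → ℝ),
      (∀ j, χ j ≠ 1) →
      (∀ j, DirichletCharacter.LFunction (χ j) (1/2 + Complex.I * γ j) = 0) →
      (∑ j, γ j = 0) →
      ∃ m : ℕ, n = 2 * m ∧ ∃ i j : Fin m → Fin n,
        (Set.range i ∪ Set.range j = Set.univ) ∧
        ∀ k : Fin m, γ (i k) + γ (j k) = 0 ∧
          ∀ a : ZMod q, (χ (j k)) a = (starRingEnd ℂ) ((χ (i k)) a) := by
  intro q _ hq n χ γ hχ hzero hsum
  have hLIq := hLI q hq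
  have hmem : ∀ j, ∃ z : {p : DirichletCharacter ℂ q × ℂ × ℕ //
      1/2 ≤ p.2.1.re ∧ 0 ≤ p.2.1.im ∧ DirichletCharacter.LFunction p.1 p.2.1 = 0 ∧
      p.2.2 < zeroOrder (DirichletCharacter.LFunction p.1) p.2.1},
      z.1.1 = (if 0 < γ j then χ j else (χ j)⁻¹) ∧ z.1.2.1.im = |γ j| := by
    intro j
    by_cases hj : 0 < γ j
    · refine ⟨⟨(χ j, 1/2 + Complex.I * γ j, 0), by simp, by simpa using hj.le, hzero j,
        DirichletCharacter.zeroOrder_LFunction_pos (hχ j) (hzero j)⟩, by simp [hj], ?_⟩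
      simp [abs_of_pos hj]
    · have h0 : DirichletCharacter.LFunction (χ j)⁻¹ (1/2 - Complex.I * γ j) = 0 := by
        have := DirichletCharacter.conj_LFunction (hχ j) (1/2 + Complex.I * γ j)
        rw [hzero j] at this
        simpa [sub_eq_add_neg, map_ofNat] using this.symm
      refine ⟨⟨((χ j)⁻¹, 1/2 - Complex.I * γ j, 0), by simp, by simpa using hj, h0,
        DirichletCharacter.zeroOrder_LFunction_pos (inv_ne_one.mpr (hχ j)) h0⟩, by simp [hj], ?_⟩
      simp [abs_of_nonpos (not_lt.mp hj)]
  choose z hzχ hzγ using hmem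
  obtain ⟨m, hm, i, j, hij, hpair⟩ := exists_pairing z (0 < γ ·)
    (hLIq.card_eq_of_signed_sum_eq_zero z (0 < γ ·) (by
      refine Eq.trans ?_ hsum
      refine Finset.sum_congr rfl fun k _ ↦ ?_
      rw [hzγ]
      split_ifs with hk
      · exact abs_of_pos hk
      · rw [abs_of_nonpos (not_lt.mp hk), neg_neg]))
  refine ⟨m, hm, i, j, hij, fun k ↦ ?_⟩
  obtain ⟨heq, hi, hj⟩ := hpair k
  have h1 := hzχ (i k)
  have h2 := hzγ (i k)
  rw [heq, hzχ, if_pos hi, if_neg hj] at h1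
  rw [heq, hzγ, abs_of_pos hi, abs_of_nonpos (not_lt.mp hj)] at h2
  refine ⟨by linarith, fun a ↦ ?_⟩
  rw [starRingEnd_apply, MulChar.star_apply', ← h1, inv_inv]
end

section
/- For r ≥ 1 and n ≥ 2, the cardinality of F_{2r,n} equals μ_{2r}·ν_n^r, where μ_{2r} = (2r)!/(2^r·r!) and ν_n := n!² ∑_{(k,m): k≥2, m≥0, k+2m=n} 1/(k!·2^{2m}·m!²). -/
/-- `J_{μ,ν}(π)`: the elements of row `μ` sent to row `ν` by `π`. -/
def Jset {s n : ℕ} (π : Fin s × Fin n → Fin s × Fin n) (μ ν : Fin s) :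
    Finset (Fin s × Fin n) :=
  Finset.univ.filter (fun x => x.1 = μ ∧ (π x).1 = ν)

/-- The combinatorial constant `ν_n`. -/
noncomputable def nuConst (n : ℕ) : ℝ :=
  (n.factorial : ℝ)^2 * ∑ m ∈ Finset.range (n+1),
    if 2 * m + 2 ≤ n then
      (1 : ℝ) / ((n - 2*m).factorial * 2^(2*m) * ((m.factorial : ℝ))^2)
    else 0

/-- Membership in `F_{2r,n}` (stated for a general number of rows `s`): a fixed-point-free
involution of `{1,…,s} × {1,…,n}` such that each row is paired with exactly one other row, and
each row exchanges at least two elements with other rows. -/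
def MemF {s n : ℕ} (π : Fin s × Fin n → Fin s × Fin n) : Prop :=
  Function.Involutive π ∧ (∀ x, π x ≠ x) ∧
  (∀ μ : Fin s, ∃! ν : Fin s, ν ≠ μ ∧ (Jset π μ ν).Nonempty) ∧
  (∀ μ : Fin s, 2 ≤ ∑ ν ∈ Finset.univ.filter (fun ν => ν ≠ μ), (Jset π μ ν).card)

open Equiv.Perm in
theorem card_perm_cycleType_replicate_two {α : Type*} [Fintype α] [DecidableEq α] (m : ℕ)
    (h : 2 * m ≤ Fintype.card α) :
    ((Finset.univ.filter
        (fun g : Equiv.Perm α => g.cycleType = Multiset.replicate m 2)).card : ℝ)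
      = ((Fintype.card α).factorial : ℝ)
        / (((Fintype.card α - 2 * m).factorial : ℝ) * 2 ^ m * (m.factorial : ℝ)) := by
  have key := card_of_cycleType_mul_eq α (Multiset.replicate m 2)
  have hcond : (Multiset.replicate m 2).sum ≤ Fintype.card α ∧
      ∀ a ∈ Multiset.replicate m 2, 2 ≤ a := by
    refine ⟨by simpa [mul_comm] using h, fun a ha => ?_⟩
    rw [Multiset.eq_of_mem_replicate ha]
  have hprod : ∏ k ∈ (Multiset.replicate m 2).toFinset,
      ((Multiset.replicate m 2).count k).factorial = m.factorial := by
    rcases Nat.eq_zero_or_pos m with rfl | hm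
    · simp
    · rw [Multiset.toFinset_replicate, if_neg hm.ne']
      simp
  rw [if_pos hcond, hprod, Multiset.prod_replicate, Multiset.sum_replicate, smul_eq_mul,
    mul_comm m 2] at key
  rw [eq_div_iff (by positivity)]
  exact_mod_cast key

theorem cycleType_eq_replicate_of_involutive {α : Type*} [Fintype α] [DecidableEq α]
    {σ : Equiv.Perm α} (h : Function.Involutive σ) :
    σ.cycleType = Multiset.replicate (Multiset.card σ.cycleType) 2 := by
  rw [Multiset.eq_replicate]
  refine ⟨rfl, Equiv.Perm.pow_prime_eq_one_iff.1 ?_⟩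
  ext x
  simp [pow_two, h x]

theorem involutive_of_cycleType_eq_replicate {α : Type*} [Fintype α] [DecidableEq α]
    {σ : Equiv.Perm α} {m : ℕ} (h : σ.cycleType = Multiset.replicate m 2) :
    Function.Involutive σ := by
  have h2 : σ ^ 2 = 1 := by
    rw [Equiv.Perm.pow_prime_eq_one_iff, h]
    exact fun c hc => Multiset.eq_of_mem_replicate hc
  intro x
  simpa [pow_two] using congrArg (fun τ : Equiv.Perm α => τ x) h2

/-- The fixed points of an involution are counted by its cycle type. -/
theorem card_fixedPoints_add_two_mul_card_cycleType {α : Type*} [Fintype α] [DecidableEq α]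
    {σ : Equiv.Perm α} (h : Function.Involutive σ) :
    Fintype.card {x // σ x = x} + 2 * Multiset.card σ.cycleType = Fintype.card α := by
  have h1 := σ.sum_cycleType
  rw [cycleType_eq_replicate_of_involutive h, Multiset.sum_replicate, smul_eq_mul] at h1
  have h2 : Fintype.card {x // ¬ σ x = x} = σ.support.card := by
    rw [Fintype.card_subtype]
    congr 1
  have h3 := Fintype.card_subtype_compl (fun x => σ x = x)
  have h4 := Fintype.card_subtype_le (fun x => σ x = x)
  lia

/-- A fixed-point-free involution. -/
def IsPairing {α : Type*} (σ : α → α) : Prop :=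
  Function.Involutive σ ∧ ∀ x, σ x ≠ x

theorem card_isPairing (r : ℕ) :
    (Nat.card {σ : Equiv.Perm (Fin (2 * r)) // IsPairing σ} : ℝ)
      = ((2 * r).factorial : ℝ) / (2 ^ r * (r.factorial : ℝ)) := by
  classical
  rw [Nat.card_eq_fintype_card, Fintype.card_subtype]
  have h := card_perm_cycleType_replicate_two (α := Fin (2 * r)) r (by simp)
  simp only [Fintype.card_fin, Nat.sub_self, Nat.factorial_zero, Nat.cast_one, one_mul] at h
  rw [← h]
  congr 2
  ext σ
  constructor
  · rintro h
    simp only [Finset.mem_filter, Finset.mem_univ, true_and] at h ⊢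
    obtain ⟨h1, h2⟩ := h
    have h3 := card_fixedPoints_add_two_mul_card_cycleType h1
    have : IsEmpty {x // σ x = x} := ⟨fun x => h2 x x.2⟩
    rw [Fintype.card_eq_zero, Fintype.card_fin] at h3
    rw [cycleType_eq_replicate_of_involutive h1]
    congr 1
    lia
  · intro h
    simp only [Finset.mem_filter, Finset.mem_univ, true_and] at h ⊢
    have h1 := involutive_of_cycleType_eq_replicate h
    have h3 := card_fixedPoints_add_two_mul_card_cycleType h1
    rw [h, Multiset.card_replicate, Fintype.card_fin] at h3
    have h4 : Fintype.card {x // σ x = x} = 0 := by lia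
    rw [Fintype.card_eq_zero_iff] at h4
    exact ⟨h1, fun x hx => h4.false ⟨x, hx⟩⟩

/-- `π` is a fixed-point-free involution mapping each row `μ` into the rows `μ` and `σ μ`, with at
least two elements of each row leaving it. -/
def Linked {α β : Type*} [Fintype β] [DecidableEq α] (σ : α → α) (π : α × β → α × β) : Prop :=
  IsPairing π ∧ (∀ x, (π x).1 = x.1 ∨ (π x).1 = σ x.1) ∧
  ∀ μ, 2 ≤ (Finset.univ.filter (fun i : β => (π (μ, i)).1 ≠ μ)).card

theorem Linked.exists_fst_eq {α β : Type*} [Fintype β] [DecidableEq α] {σ : α → α}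
    {π : α × β → α × β} (h : Linked σ π) (μ : α) : ∃ i, (π (μ, i)).1 ≠ μ ∧ (π (μ, i)).1 = σ μ := by
  have h0 : 0 < (Finset.univ.filter (fun i : β => (π (μ, i)).1 ≠ μ)).card :=
    lt_of_lt_of_le (by norm_num) (h.2.2 μ)
  obtain ⟨i, hi⟩ := Finset.card_pos.1 h0
  simp only [Finset.mem_filter, Finset.mem_univ, true_and] at hi
  exact ⟨i, hi, (h.2.1 (μ, i)).resolve_left hi⟩

theorem Linked.unique {α β : Type*} [Fintype β] [DecidableEq α] {σ τ : α → α}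
    {π : α × β → α × β} (h : Linked σ π) (h' : Linked τ π) : σ = τ := by
  funext μ
  obtain ⟨i, hi, hs⟩ := h.exists_fst_eq μ
  rw [← hs]
  exact (h'.2.1 (μ, i)).resolve_left hi

theorem sum_card_Jset {s n : ℕ} (π : Fin s × Fin n → Fin s × Fin n) (μ : Fin s) :
    ∑ ν ∈ Finset.univ.filter (fun ν => ν ≠ μ), (Jset π μ ν).card
      = (Finset.univ.filter (fun i : Fin n => (π (μ, i)).1 ≠ μ)).card := by
  rw [Finset.card_eq_sum_card_fiberwise (f := fun i => (π (μ, i)).1)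
    (t := Finset.univ.filter (fun ν => ν ≠ μ)) (by intro i hi; simpa using hi)]
  refine Finset.sum_congr rfl fun ν hν => ?_
  simp only [Finset.mem_filter, Finset.mem_univ, true_and] at hν
  symm
  refine Finset.card_bij (fun i _ => (μ, i)) ?_ ?_ ?_
  · intro i hi
    simp only [Finset.mem_filter, Finset.mem_univ, true_and] at hi
    simp [Jset, hi.2]
  · intro i _ j _ hij
    simpa using hij
  · rintro ⟨x, i⟩ hx
    simp only [Jset, Finset.mem_filter, Finset.mem_univ, true_and] at hx
    obtain ⟨rfl, hx⟩ := hx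
    exact ⟨i, by simp [hx, hν], rfl⟩

theorem MemF.exists_linked {s n : ℕ} {π : Fin s × Fin n → Fin s × Fin n} (h : MemF π) :
    ∃ σ : Equiv.Perm (Fin s), IsPairing σ ∧ Linked σ π := by
  obtain ⟨hinv, hfix, huniq, hcard⟩ := h
  choose p hp hu using huniq
  have hpinv : Function.Involutive p := by
    intro μ
    obtain ⟨x, hx⟩ := (hp μ).2
    simp only [Jset, Finset.mem_filter, Finset.mem_univ, true_and] at hx
    refine (hu (p μ) μ ⟨(hp μ).1.symm, π x, ?_⟩).symm
    simp [Jset, hinv x, hx]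
  refine ⟨hpinv.toPerm p, ⟨hpinv, fun μ => (hp μ).1⟩, ⟨hinv, hfix⟩, ?_, ?_⟩
  · intro x
    by_cases hx : (π x).1 = x.1
    · exact Or.inl hx
    · exact Or.inr (hu x.1 _ ⟨hx, x, by simp [Jset]⟩)
  · intro μ
    rw [← sum_card_Jset]
    exact hcard μ

theorem Linked.memF {s n : ℕ} {σ : Fin s → Fin s} {π : Fin s × Fin n → Fin s × Fin n}
    (h : Linked σ π) : MemF π := by
  refine ⟨h.1.1, h.1.2, fun μ => ?_, fun μ => ?_⟩
  · obtain ⟨i, hi, hs⟩ := h.exists_fst_eq μ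
    refine ⟨σ μ, ⟨hs ▸ hi, (μ, i), by simp [Jset, hs]⟩, ?_⟩
    rintro ν ⟨hν, x, hx⟩
    simp only [Jset, Finset.mem_filter, Finset.mem_univ, true_and] at hx
    obtain ⟨rfl, rfl⟩ := hx
    exact (h.2.1 x).resolve_left hν
  · rw [sum_card_Jset]
    exact h.2.2 μ

theorem card_memF (s n : ℕ) :
    Nat.card {π : Fin s × Fin n → Fin s × Fin n // MemF π}
      = Nat.card (Σ σ : {σ : Equiv.Perm (Fin s) // IsPairing σ},
          {π : Fin s × Fin n → Fin s × Fin n // Linked σ.1 π}) := by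
  refine (Nat.card_congr (Equiv.ofBijective
    (fun p => ⟨p.2.1, p.2.2.memF⟩) ⟨?_, ?_⟩)).symm
  · rintro ⟨⟨σ, hσ⟩, ⟨π, hπ⟩⟩ ⟨⟨τ, hτ⟩, ⟨π', hπ'⟩⟩ h
    obtain rfl : π = π' := congrArg Subtype.val h
    obtain rfl : σ = τ := DFunLike.coe_injective (hπ.unique hπ')
    rfl
  · rintro ⟨π, hπ⟩
    obtain ⟨σ, hσ, h⟩ := hπ.exists_linked
    exact ⟨⟨⟨σ, hσ⟩, ⟨π, h⟩⟩, rfl⟩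

theorem exists_equiv_prod_bool {r : ℕ} {σ : Fin (2 * r) → Fin (2 * r)} (h : IsPairing σ) :
    ∃ φ : Fin r × Bool ≃ Fin (2 * r), ∀ t b, φ (t, !b) = σ (φ (t, b)) := by
  let T := {μ // μ < σ μ}
  let f : T × Bool → Fin (2 * r) := fun p => if p.2 then σ p.1.1 else p.1.1
  have hf : Function.Bijective f := by
    constructor
    · rintro ⟨⟨x, hx⟩, b⟩ ⟨⟨y, hy⟩, c⟩ hxy
      have h1 := h.1 x
      have h2 := h.1 y
      cases b <;> cases c <;> simp only [f, if_true, Bool.false_eq_true, if_false] at hxy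
      · subst hxy; rfl
      · rw [hxy, h2] at hx; exact absurd hx hy.not_gt
      · rw [← hxy, h1] at hy; exact absurd hy hx.not_gt
      · obtain rfl := h.1.injective hxy; rfl
    · intro x
      rcases lt_or_gt_of_ne (h.2 x) with hx | hx
      · exact ⟨(⟨σ x, by rwa [h.1 x]⟩, true), by simp [f, h.1 x]⟩
      · exact ⟨(⟨x, hx⟩, false), by simp [f]⟩
  let e := Equiv.ofBijective f hf
  have hT : Fintype.card T = r := by
    have := Fintype.card_congr e
    simp only [Fintype.card_prod, Fintype.card_bool, Fintype.card_fin] at this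
    lia
  refine ⟨((Fintype.equivFinOfCardEq hT).symm.prodCongr (Equiv.refl Bool)).trans e, ?_⟩
  rintro t (_ | _)
  · simp [e, f]
  · simp [e, f, h.1 _]

/-- A map that is the disjoint union of maps `g t` on pairs of rows is linked if and only if each
`g t` is. -/
theorem linked_iff_forall_linked_not {α β τ : Type*} [Fintype β] [DecidableEq α]
    {σ : α → α} (φ : τ × Bool ≃ α) (hφ : ∀ t b, φ (t, !b) = σ (φ (t, b)))
    {π : α × β → α × β} {g : τ → Bool × β → Bool × β}
    (hg : ∀ t b i, π (φ (t, b), i) = (φ (t, (g t (b, i)).1), (g t (b, i)).2)) :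
    Linked σ π ↔ ∀ t, Linked not (g t) := by
  have hall : ∀ P : α → Prop, (∀ μ, P μ) ↔ ∀ t b, P (φ (t, b)) := fun P => by
    rw [← φ.forall_congr_right, Prod.forall]
  have h1 : (∀ x, π (π x) = x) ↔ ∀ t x, g t (g t x) = x := by
    simp only [Prod.forall, hall, hg]
    simp [Prod.ext_iff]
  have h2 : (∀ x, π x ≠ x) ↔ ∀ t x, g t x ≠ x := by
    simp only [Prod.forall, hall, hg]
    simp [Prod.ext_iff]
  have h3 : ∀ x, (π x).1 = x.1 ∨ (π x).1 = σ x.1 := by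
    simp only [Prod.forall, hall, hg, ← hφ]
    intro t b i
    cases b <;> cases (g t (_, i)).1 <;> simp
  have h4 : ∀ t (x : Bool × β), (g t x).1 = x.1 ∨ (g t x).1 = !x.1 := by
    intro t x
    cases (g t x).1 <;> cases x.1 <;> simp
  have h5 : (∀ μ, 2 ≤ (Finset.univ.filter (fun i : β => (π (μ, i)).1 ≠ μ)).card) ↔
      ∀ t b, 2 ≤ (Finset.univ.filter (fun i : β => (g t (b, i)).1 ≠ b)).card := by
    simp only [hall, hg]
    simp
  unfold Linked IsPairing Function.Involutive
  rw [h1, h2, h5]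
  constructor
  · rintro ⟨⟨a, b⟩, -, c⟩ t
    exact ⟨⟨a t, b t⟩, h4 t, c t⟩
  · intro h
    exact ⟨⟨fun t => (h t).1.1, fun t => (h t).1.2⟩, h3, fun t => (h t).2.2⟩

theorem nonempty_linked_equiv {α β τ : Type*} [Fintype β] [DecidableEq α]
    {σ : α → α} (φ : τ × Bool ≃ α) (hφ : ∀ t b, φ (t, !b) = σ (φ (t, b))) :
    Nonempty ({π : α × β → α × β // Linked σ π} ≃
      (τ → {g : Bool × β → Bool × β // Linked not g})) := by
  let F : (τ → Bool × β → Bool × β) → α × β → α × β := fun g x =>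
    (φ ((φ.symm x.1).1, (g (φ.symm x.1).1 ((φ.symm x.1).2, x.2)).1),
      (g (φ.symm x.1).1 ((φ.symm x.1).2, x.2)).2)
  have hF : ∀ g t b i, F g (φ (t, b), i) = (φ (t, (g t (b, i)).1), (g t (b, i)).2) := by
    intro g t b i
    simp [F]
  refine ⟨(Equiv.ofBijective (fun g => ⟨F fun t => (g t).1,
    (linked_iff_forall_linked_not φ hφ (hF _)).2 fun t => (g t).2⟩) ⟨?_, ?_⟩).symm⟩
  · intro g g' h
    have h := congrArg Subtype.val h
    funext t
    apply Subtype.ext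
    funext ⟨b, i⟩
    have h' := congrFun h (φ (t, b), i)
    simp only [hF, Prod.mk.injEq, EmbeddingLike.apply_eq_iff_eq, true_and] at h'
    exact Prod.ext h'.1 h'.2
  · rintro ⟨π, hπ⟩
    let g : τ → Bool × β → Bool × β := fun t x =>
      ((φ.symm (π (φ (t, x.1), x.2)).1).2, (π (φ (t, x.1), x.2)).2)
    have hg : ∀ t b i, π (φ (t, b), i) = (φ (t, (g t (b, i)).1), (g t (b, i)).2) := by
      intro t b i
      have ht : (φ.symm (π (φ (t, b), i)).1).1 = t := by
        rcases hπ.2.1 (φ (t, b), i) with h | h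
        · simp [h]
        · rw [h, ← hφ]
          simp
      refine Prod.ext ?_ rfl
      rw [← φ.symm_apply_eq]
      exact Prod.ext ht rfl
    refine ⟨fun t => ⟨g t, (linked_iff_forall_linked_not φ hφ hg).1 hπ t⟩, ?_⟩
    apply Subtype.ext
    funext ⟨μ, i⟩
    obtain ⟨⟨t, b⟩, rfl⟩ := φ.surjective μ
    exact (hF _ t b i).trans (hg t b i).symm

/-- Two permutations together with a bijection of their fixed points, as a map on two rows. -/
def glue {β : Type*} [DecidableEq β] (a b : Equiv.Perm β)
    (e : {i // a i = i} ≃ {i // b i = i}) : Bool × β → Bool × β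
  | (false, i) => if h : a i = i then (true, e ⟨i, h⟩) else (false, a i)
  | (true, i) => if h : b i = i then (false, e.symm ⟨i, h⟩) else (true, b i)

section glue

variable {β : Type*} [DecidableEq β] {a b : Equiv.Perm β} (e : {i // a i = i} ≃ {i // b i = i})

theorem glue_false_of_eq {i : β} (h : a i = i) : glue a b e (false, i) = (true, (e ⟨i, h⟩).1) := by
  simp [glue, h]

theorem glue_false_of_ne {i : β} (h : a i ≠ i) : glue a b e (false, i) = (false, a i) := by
  simp [glue, h]

theorem glue_true_of_eq {i : β} (h : b i = i) :
    glue a b e (true, i) = (false, (e.symm ⟨i, h⟩).1) := by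
  simp [glue, h]

theorem glue_true_of_ne {i : β} (h : b i ≠ i) : glue a b e (true, i) = (true, b i) := by
  simp [glue, h]

theorem glue_linked [Fintype β] (ha : Function.Involutive a) (hb : Function.Involutive b)
    (hcard : 2 ≤ Fintype.card {i // a i = i}) : Linked not (glue a b e) := by
  refine ⟨⟨?_, ?_⟩, ?_, ?_⟩
  · rintro ⟨_ | _, i⟩
    · by_cases h : a i = i
      · rw [glue_false_of_eq e h, glue_true_of_eq e (e ⟨i, h⟩).2]
        simp
      · rw [glue_false_of_ne e h, glue_false_of_ne e (by rw [ha i]; exact Ne.symm h), ha i]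
    · by_cases h : b i = i
      · rw [glue_true_of_eq e h, glue_false_of_eq e (e.symm ⟨i, h⟩).2]
        simp
      · rw [glue_true_of_ne e h, glue_true_of_ne e (by rw [hb i]; exact Ne.symm h), hb i]
  · rintro ⟨_ | _, i⟩
    · by_cases h : a i = i
      · simp [glue_false_of_eq e h]
      · simp [glue_false_of_ne e h, h]
    · by_cases h : b i = i
      · simp [glue_true_of_eq e h]
      · simp [glue_true_of_ne e h, h]
  · rintro ⟨c, i⟩
    cases c <;> cases (glue a b e (_, i)).1 <;> simp
  · rintro (_ | _)
    · rw [Fintype.card_subtype] at hcard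
      convert hcard using 3 with i
      by_cases h : a i = i
      · simp [glue_false_of_eq e h, h]
      · simp [glue_false_of_ne e h, h]
    · rw [Fintype.card_congr e, Fintype.card_subtype] at hcard
      convert hcard using 3 with i
      by_cases h : b i = i
      · simp [glue_true_of_eq e h, h]
      · simp [glue_true_of_ne e h, h]

theorem glue_injective {a' b' : Equiv.Perm β} {e' : {i // a' i = i} ≃ {i // b' i = i}}
    (h : glue a b e = glue a' b' e') : a = a' ∧ b = b' ∧ ∀ i j, (e i).1 = j ↔
      ∃ hi, (e' ⟨i.1, hi⟩).1 = j := by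
  have ha : a = a' := by
    ext i
    have hi := congrFun h (false, i)
    by_cases h1 : a i = i <;> by_cases h2 : a' i = i
    · rw [h1, h2]
    · simp [glue_false_of_eq e h1, glue_false_of_ne e' h2] at hi
    · simp [glue_false_of_ne e h1, glue_false_of_eq e' h2] at hi
    · simpa [glue_false_of_ne e h1, glue_false_of_ne e' h2] using hi
  have hb : b = b' := by
    ext i
    have hi := congrFun h (true, i)
    by_cases h1 : b i = i <;> by_cases h2 : b' i = i
    · rw [h1, h2]
    · simp [glue_true_of_eq e h1, glue_true_of_ne e' h2] at hi
    · simp [glue_true_of_ne e h1, glue_true_of_eq e' h2] at hi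
    · simpa [glue_true_of_ne e h1, glue_true_of_ne e' h2] using hi
  subst ha hb
  refine ⟨rfl, rfl, fun i j => ?_⟩
  have hi := congrFun h (false, i.1)
  rw [glue_false_of_eq e i.2, glue_false_of_eq e' i.2, Prod.mk.injEq] at hi
  rw [hi.2]
  exact ⟨fun hj => ⟨i.2, hj⟩, fun ⟨_, hj⟩ => hj⟩

end glue

theorem exists_glue_eq {β : Type*} [Fintype β] [DecidableEq β] {g : Bool × β → Bool × β}
    (hg : Linked not g) :
    ∃ (a b : Equiv.Perm β) (e : {i // a i = i} ≃ {i // b i = i}),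
      (Function.Involutive a ∧ Function.Involutive b ∧ 2 ≤ Fintype.card {i // a i = i}) ∧
      glue a b e = g := by
  obtain ⟨⟨hinv, hfix⟩, -, hcard⟩ := hg
  let p : Bool → β → β := fun c i => if (g (c, i)).1 = c then (g (c, i)).2 else i
  have hin : ∀ c i, (g (c, i)).1 = c → g (c, i) = (c, p c i) := by
    intro c i h
    exact Prod.ext h (by simp [p, h])
  have hp : ∀ c, Function.Involutive (p c) := by
    intro c i
    by_cases h : (g (c, i)).1 = c
    · have h1 := hinv (c, i)
      rw [hin c i h] at h1
      rw [hin c (p c i) (by rw [h1])] at h1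
      exact congrArg Prod.snd h1
    · have h1 : p c i = i := by simp [p, h]
      rw [h1, h1]
  have hpfix : ∀ c i, p c i = i ↔ (g (c, i)).1 = !c := by
    intro c i
    by_cases h : (g (c, i)).1 = c
    · rw [h]
      refine ⟨fun h1 => absurd (hin c i h) ?_, fun h1 => by simp at h1⟩
      rw [h1]
      exact hfix _
    · have h1 : p c i = i := by simp [p, h]
      simp [h1, Bool.eq_not_of_ne h]
  have hout : ∀ c i, p c i = i → g (c, i) = (!c, (g (c, i)).2) := fun c i h =>
    Prod.ext ((hpfix c i).1 h) rfl
  have hback : ∀ c i, p c i = i → g (!c, (g (c, i)).2) = (c, i) := fun c i h => by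
    rw [← hout c i h, hinv]
  let e : {i // (hp false).toPerm (p false) i = i} ≃ {i // (hp true).toPerm (p true) i = i} :=
    { toFun := fun i => ⟨(g (false, i.1)).2, (hpfix true _).2 <| by
        have := hback false i.1 i.2
        simp only [Bool.not_false] at this
        simp [this]⟩
      invFun := fun i => ⟨(g (true, i.1)).2, (hpfix false _).2 <| by
        have := hback true i.1 i.2
        simp only [Bool.not_true] at this
        simp [this]⟩
      left_inv := fun i => Subtype.ext (congrArg Prod.snd (hback false i.1 i.2))
      right_inv := fun i => Subtype.ext (congrArg Prod.snd (hback true i.1 i.2)) }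
  refine ⟨(hp false).toPerm (p false), (hp true).toPerm (p true), e,
    ⟨hp false, hp true, ?_⟩, ?_⟩
  · rw [Fintype.card_subtype]
    convert hcard false using 3 with i
    simpa using hpfix false i
  · funext ⟨c, i⟩
    cases c
    · by_cases h : p false i = i
      · rw [glue_false_of_eq e h, hout false i h]
        rfl
      · rw [glue_false_of_ne e h, hin false i (by simpa using mt (hpfix false i).2 h)]
        rfl
    · by_cases h : p true i = i
      · rw [glue_true_of_eq e h, hout true i h]
        rfl
      · rw [glue_true_of_ne e h, hin true i (by simpa using mt (hpfix true i).2 h)]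
        rfl

theorem card_linked_not {β : Type*} [Fintype β] [DecidableEq β] :
    Nat.card {g : Bool × β → Bool × β // Linked not g}
      = ∑ p : Equiv.Perm β × Equiv.Perm β, Nat.card
          {_e : {i // p.1 i = i} ≃ {i // p.2 i = i} // Function.Involutive p.1 ∧
            Function.Involutive p.2 ∧ 2 ≤ Fintype.card {i // p.1 i = i}} := by
  rw [← Nat.card_sigma]
  refine (Nat.card_congr (Equiv.ofBijective
    (fun q => ⟨glue q.1.1 q.1.2 q.2.1, glue_linked _ q.2.2.1 q.2.2.2.1 q.2.2.2.2⟩)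
    ⟨?_, ?_⟩)).symm
  · rintro ⟨⟨a, b⟩, e, he⟩ ⟨⟨a', b'⟩, e', he'⟩ h
    obtain ⟨h1, h2, h3⟩ := glue_injective e (congrArg Subtype.val h)
    dsimp only at h1 h2 e e'
    subst h1 h2
    obtain rfl : e = e' := by
      ext i
      exact (h3 i _).2 ⟨i.2, rfl⟩
    rfl
  · rintro ⟨g, hg⟩
    obtain ⟨a, b, e, he, rfl⟩ := exists_glue_eq hg
    exact ⟨⟨(a, b), ⟨e, he⟩⟩, rfl⟩

theorem card_fixedPoints_equiv {β : Type*} [Fintype β] [DecidableEq β] (a b : Equiv.Perm β) :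
    Nat.card {_e : {i // a i = i} ≃ {i // b i = i} // Function.Involutive a ∧
        Function.Involutive b ∧ 2 ≤ Fintype.card {i // a i = i}}
      = ∑ m ∈ Finset.range (Fintype.card β + 1), if 2 * m + 2 ≤ Fintype.card β then
          (if a.cycleType = Multiset.replicate m 2 then 1 else 0) *
          (if b.cycleType = Multiset.replicate m 2 then 1 else 0) *
          (Fintype.card β - 2 * m).factorial else 0 := by
  by_cases hne : Nonempty {_e : {i // a i = i} ≃ {i // b i = i} // Function.Involutive a ∧
        Function.Involutive b ∧ 2 ≤ Fintype.card {i // a i = i}}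
  · obtain ⟨e, h⟩ := hne
    have ha := card_fixedPoints_add_two_mul_card_cycleType h.1
    have hb := card_fixedPoints_add_two_mul_card_cycleType h.2.1
    have hab := Fintype.card_congr e
    have h2 := h.2.2
    have hm : Multiset.card b.cycleType = Multiset.card a.cycleType := by lia
    have hca := cycleType_eq_replicate_of_involutive h.1
    have hcb := cycleType_eq_replicate_of_involutive h.2.1
    rw [hm] at hcb
    rw [Finset.sum_eq_single (Multiset.card a.cycleType)]
    · rw [if_pos (by lia), if_pos hca, if_pos hcb, one_mul, one_mul,
        Nat.card_congr (Equiv.subtypeUnivEquiv fun _ => h), Nat.card_eq_fintype_card,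
        Fintype.card_equiv e]
      congr 1
      lia
    · intro m _ hne
      rw [if_neg (c := a.cycleType = _)]
      · simp
      · intro h'
        rw [h', Multiset.card_replicate] at hne
        exact hne rfl
    · intro hn
      simp only [Finset.mem_range] at hn
      lia
  · rw [not_nonempty_iff] at hne
    rw [Nat.card_of_isEmpty, eq_comm, Finset.sum_eq_zero]
    intro m _
    by_contra hcon
    simp only [ite_eq_right_iff, Classical.not_imp, mul_eq_zero, not_or, one_ne_zero,
      imp_false, not_not] at hcon
    obtain ⟨hm, ⟨hca, hcb⟩, -⟩ := hcon
    have h1 := involutive_of_cycleType_eq_replicate hca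
    have h2 := involutive_of_cycleType_eq_replicate hcb
    have h3 := card_fixedPoints_add_two_mul_card_cycleType h1
    have h4 := card_fixedPoints_add_two_mul_card_cycleType h2
    rw [hca, Multiset.card_replicate] at h3
    rw [hcb, Multiset.card_replicate] at h4
    exact hne.false ⟨Fintype.equivOfCardEq (by lia), h1, h2, by lia⟩

theorem card_linked_not_eq_nuConst (n : ℕ) :
    (Nat.card {g : Bool × Fin n → Bool × Fin n // Linked not g} : ℝ) = nuConst n := by
  rw [card_linked_not]
  simp only [card_fixedPoints_equiv, Fintype.card_fin]
  rw [Finset.sum_comm, nuConst, Finset.mul_sum, Nat.cast_sum]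
  refine Finset.sum_congr rfl fun m _ => ?_
  split_ifs with hm
  · have h := card_perm_cycleType_replicate_two (α := Fin n) m (by simp; lia)
    rw [Fintype.card_fin] at h
    rw [← Finset.sum_mul, Fintype.sum_prod_type]
    have hsum := Fintype.sum_mul_sum
      (fun a : Equiv.Perm (Fin n) => if a.cycleType = Multiset.replicate m 2 then 1 else 0)
      (fun b : Equiv.Perm (Fin n) => if b.cycleType = Multiset.replicate m 2 then 1 else 0)
    rw [Finset.sum_boole] at hsum
    rw [← hsum]
    push_cast
    rw [h]
    field_simp
    ring
  · simp

/-- **Lemma (cardinality of `F_{2r,n}`).** `|F_{2r,n}| = μ_{2r} ν_n^r`. -/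
theorem moments_of_primes_stmt18 (r n : ℕ) (hr : 1 ≤ r) (hn : 2 ≤ n) :
    (Nat.card {π : Fin (2*r) × Fin n → Fin (2*r) × Fin n // MemF π} : ℝ)
      = (((2*r).factorial : ℝ) / (2^r * (r.factorial : ℝ))) * (nuConst n) ^ r := by
  have key : ∀ σ : {σ : Equiv.Perm (Fin (2 * r)) // IsPairing σ},
      Nonempty ({π : Fin (2 * r) × Fin n → Fin (2 * r) × Fin n // Linked σ.1 π} ≃
        (Fin r → {g : Bool × Fin n → Bool × Fin n // Linked not g})) := fun σ => by
    obtain ⟨φ, hφ⟩ := exists_equiv_prod_bool σ.2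
    exact nonempty_linked_equiv φ hφ
  rw [card_memF, Nat.card_congr (Equiv.sigmaCongrRight fun σ => (key σ).some),
    Nat.card_congr (Equiv.sigmaEquivProd _ _), Nat.card_prod, Nat.card_fun, Nat.card_fin]
  push_cast
  rw [card_isPairing, card_linked_not_eq_nuConst]
end
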